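/- Let D be the directed graph with vertex set {s,t,a,b,c,d} and arc set {(a,s),(s,a),(s,c),(c,a),(a,b),(b,c),(c,b),(d,c),(b,d),(d,t),(t,d),(t,b)}, and call a,b,c,d the internal vertices. Then: (i) for every vertex v of D there exists u ∈ {s,t} such that every directed path from v to u contains at least three internal vertices; (ii) every internal vertex has an incoming arc from s or from t; (iii) for every internal vertex w, the graph obtained from D by deleting w contains a directed s→t path or a directed t→s path that passes through exactly three internal vertices. -/

import Mathlib

/-- The vertices of the graph `D` used in the `(3/2 - ε)`-inapproximability proof for
NodeDoubleCut. -/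
inductive Vtx : Type
  | s | t | a | b | c | d
  deriving DecidableEq

/-- The arcs of `D`. -/
def arcD : Vtx → Vtx → Prop := fun u v =>
  (u, v) ∈ ([(Vtx.a, Vtx.s), (Vtx.s, Vtx.a), (Vtx.s, Vtx.c), (Vtx.c, Vtx.a),
    (Vtx.a, Vtx.b), (Vtx.b, Vtx.c), (Vtx.c, Vtx.b), (Vtx.d, Vtx.c),
    (Vtx.b, Vtx.d), (Vtx.d, Vtx.t), (Vtx.t, Vtx.d), (Vtx.t, Vtx.b)] :
      List (Vtx × Vtx))

/-- `p` is a (simple) directed path from `u` to `w` with respect to arc relation `E`,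
given as the list of its vertices. -/
def DiPath {V : Type*} (E : V → V → Prop) (u w : V) (p : List V) : Prop :=
  p.Chain' E ∧ p.head? = some u ∧ p.getLast? = some w ∧ p.Nodup

/-- The internal vertices of `D` are `a`, `b`, `c`, `d`. -/
def Vtx.isInternal : Vtx → Bool
  | Vtx.a => true
  | Vtx.b => true
  | Vtx.c => true
  | Vtx.d => true
  | _ => false

instance (u v : Vtx) : Decidable (arcD u v) := by unfold arcD; infer_instance

/-- A potential that drops by at most one along internal vertices bounds the internal count. -/
theorem potential_bound (f : Vtx → ℕ)
    (hf : ∀ x y, arcD x y → f x ≤ f y + (if x.isInternal then 1 else 0))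
    (u : Vtx) (hu : f u = 0) :
    ∀ (p : List Vtx) (v : Vtx), p.IsChain arcD → p.head? = some v → p.getLast? = some u →
      f v ≤ (p.filter Vtx.isInternal).length
  | [], v, _, h, _ => by simp at h
  | [x], v, _, h, h' => by
      simp at h h'
      subst h; subst h'; omega
  | x :: y :: l, v, hc, h, h' => by
      simp at h
      subst h
      rw [List.isChain_cons_cons] at hc
      have ih := potential_bound f hf u hu (y :: l) y hc.2 rfl (by simpa using h')
      have h1 := hf x y hc.1
      rw [List.filter_cons]
      split_ifs at h1 ⊢ <;> (try simp only [List.length_cons]) <;> omega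

/-- Number of internal vertices needed to reach `t`. -/
def potT : Vtx → ℕ
  | .t => 0 | .d => 1 | .b => 2 | _ => 3

/-- Number of internal vertices needed to reach `s`. -/
def potS : Vtx → ℕ
  | .s => 0 | .a => 1 | .c => 2 | _ => 3

theorem to_t (v : Vtx) (hv : potT v = 3) (p : List Vtx) (hp : DiPath arcD v .t p) :
    3 ≤ (p.filter Vtx.isInternal).length := by
  have := potential_bound potT (by intro x y; cases x <;> cases y <;> decide) .t rfl p v
    hp.1 hp.2.1 hp.2.2.1
  omega

theorem to_s (v : Vtx) (hv : potS v = 3) (p : List Vtx) (hp : DiPath arcD v .s p) :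
    3 ≤ (p.filter Vtx.isInternal).length := by
  have := potential_bound potS (by intro x y; cases x <;> cases y <;> decide) .s rfl p v
    hp.1 hp.2.1 hp.2.2.1
  omega

/-- properties (i), (ii), (iii) of the graph `D`. -/
theorem stmt_13 :
    (∀ v : Vtx, ∃ u : Vtx, (u = Vtx.s ∨ u = Vtx.t) ∧
      ∀ p : List Vtx, DiPath arcD v u p →
        3 ≤ (p.filter Vtx.isInternal).length) ∧
    (∀ v : Vtx, v.isInternal = true → arcD Vtx.s v ∨ arcD Vtx.t v) ∧
    (∀ w : Vtx, w.isInternal = true →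
      ∃ p : List Vtx,
        (DiPath (fun x y => arcD x y ∧ x ≠ w ∧ y ≠ w) Vtx.s Vtx.t p ∨
         DiPath (fun x y => arcD x y ∧ x ≠ w ∧ y ≠ w) Vtx.t Vtx.s p) ∧
        (p.filter Vtx.isInternal).length = 3) := by
  refine ⟨?_, ?_, ?_⟩
  · intro v
    cases v
    · exact ⟨.t, Or.inr rfl, to_t _ rfl⟩
    · exact ⟨.s, Or.inl rfl, to_s _ rfl⟩
    · exact ⟨.t, Or.inr rfl, to_t _ rfl⟩
    · exact ⟨.s, Or.inl rfl, to_s _ rfl⟩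
    · exact ⟨.t, Or.inr rfl, to_t _ rfl⟩
    · exact ⟨.s, Or.inl rfl, to_s _ rfl⟩
  · intro v
    cases v <;> decide
  · intro w hw
    cases w
    · simp [Vtx.isInternal] at hw
    · simp [Vtx.isInternal] at hw
    · exact ⟨[.s, .c, .b, .d, .t], Or.inl (by simp [DiPath, arcD, List.Chain']), rfl⟩
    · exact ⟨[.t, .d, .c, .a, .s], Or.inr (by simp [DiPath, arcD, List.Chain']), rfl⟩
    · exact ⟨[.s, .a, .b, .d, .t], Or.inl (by simp [DiPath, arcD, List.Chain']), rfl⟩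
    · exact ⟨[.t, .b, .c, .a, .s], Or.inr (by simp [DiPath, arcD, List.Chain']), rfl⟩
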